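/- Let $x \ge 200$ be an integer and set $D = \prod_{k=\lceil x/2 \rceil}^{x} \big((1+i)^k - 1\big) \in \mathbb{Z}[i]$. Suppose $D$ has exactly $m$ pairwise non-associate prime factors in $\mathbb{Z}[i]$. Then the $\lfloor m/2 \rfloor$-th smallest odd rational prime $p_{\lfloor m/2 \rfloor}$ satisfies $p_{\lfloor m/2 \rfloor} < 0.130448\, x^2$. -/

import Mathlib

open GaussianInt

/-- The `j`-th smallest odd rational prime, so `oddPrime 1 = 3`, `oddPrime 2 = 5`, etc. -/
noncomputable def oddPrime (j : ℕ) : ℕ := Nat.nth (fun p => p.Prime ∧ p ≠ 2) (j - 1)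

/-- Chebyshev's factorial ratio `(30k)! k! / ((15k)! (10k)! (6k)!)` divides `lcm(1, …, 30k)`. -/
theorem factorial_thirty_mul_dvd (k : ℕ) :
    (30 * k).factorial * k.factorial ∣
      Nat.lcmUpto (30 * k) *
        ((15 * k).factorial * (10 * k).factorial * (6 * k).factorial) := by
  have hf := Nat.factorial_ne_zero
  have hl := Nat.lcmUpto_ne_zero (30 * k)
  rw [← Nat.factorization_prime_le_iff_dvd (mul_ne_zero (hf _) (hf _))
    (mul_ne_zero hl (mul_ne_zero (mul_ne_zero (hf _) (hf _)) (hf _)))]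
  intro p hp
  rw [Nat.factorization_mul (hf _) (hf _),
    Nat.factorization_mul hl (mul_ne_zero (mul_ne_zero (hf _) (hf _)) (hf _)),
    Nat.factorization_mul (mul_ne_zero (hf _) (hf _)) (hf _),
    Nat.factorization_mul (hf _) (hf _)]
  have hlog : ∀ n ≤ 30 * k, Nat.log p n < Nat.log p (30 * k) + 1 := fun n hn =>
    Nat.lt_succ_of_le (Nat.log_mono_right hn)
  simp only [Finsupp.add_apply, Nat.factorization_lcmUpto _ hp]
  rw [Nat.factorization_factorial hp (hlog (30 * k) le_rfl),
    Nat.factorization_factorial hp (hlog k (by omega)),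
    Nat.factorization_factorial hp (hlog (15 * k) (by omega)),
    Nat.factorization_factorial hp (hlog (10 * k) (by omega)),
    Nat.factorization_factorial hp (hlog (6 * k) (by omega))]
  have hcard : Nat.log p (30 * k) = ∑ _i ∈ Finset.Ico 1 (Nat.log p (30 * k) + 1), 1 := by simp
  conv_rhs => enter [1]; rw [hcard]
  simp only [← Finset.sum_add_distrib]
  refine Finset.sum_le_sum fun i _ => ?_
  have hdiv : ∀ a b, a * b = 30 → a * k / p ^ i = 30 * k / p ^ i / b := fun a b hab => by
    have hb : 0 < b := Nat.pos_of_ne_zero (by rintro rfl; simp at hab)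
    rw [Nat.div_div_eq_div_mul, ← hab, mul_right_comm, Nat.mul_div_mul_right _ _ hb]
  have h1 := hdiv 1 30 rfl
  rw [one_mul] at h1
  rw [h1, hdiv 15 2 rfl, hdiv 10 3 rfl, hdiv 6 5 rfl]
  omega

open Real in
theorem log_factorial_le {n : ℕ} (hn : n ≠ 0) :
    log n.factorial ≤ n * log n - n + log n / 2 + 1 := by
  obtain ⟨m, rfl⟩ := Nat.exists_eq_succ_of_ne_zero hn
  have h := Stirling.log_stirlingSeq'_antitone (Nat.zero_le m)
  have hpos : (0 : ℝ) < (m.succ : ℕ) := by positivity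
  have hone : Real.log (Stirling.stirlingSeq 1) = 1 - log 2 / 2 := by
    rw [Stirling.stirlingSeq_one, log_div (exp_pos _).ne' (by positivity), log_exp,
      log_sqrt (by norm_num)]
  simp only [Function.comp_apply, Nat.succ_eq_add_one, zero_add] at h
  rw [hone, Stirling.log_stirlingSeq_formula, log_mul (by norm_num) (by positivity),
    log_div (by positivity) (exp_pos _).ne', log_exp] at h
  simp only [Nat.succ_eq_add_one] at *
  linarith

open Real in
theorem chebyshev_constant_ge : 27.61 ≤ 14 * log 2 + 9 * log 3 + 5 * log 5 := by
  have h : (239 : ℕ) * log 2 ≤ (6 : ℕ) * (14 * log 2 + 9 * log 3 + 5 * log 5) := by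
    have e : 14 * log 2 + 9 * log 3 + 5 * log 5 = log (2 ^ 14 * 3 ^ 9 * 5 ^ 5) := by
      rw [log_mul (by norm_num) (by norm_num), log_mul (by norm_num) (by norm_num),
        log_pow, log_pow, log_pow]
      norm_num
    rw [e, ← log_pow, ← log_pow]
    exact log_le_log (by norm_num) (by norm_num)
  have := log_two_gt_d9
  push_cast at h
  linarith

open Real Chebyshev in
theorem psi_thirty_mul_ge {k : ℕ} (hk : k ≠ 0) :
    27.61 * k - log k / 2 - 3.36 ≤ ψ ((30 * k : ℕ) : ℝ) := by
  have hk0 : (0 : ℝ) < k := by positivity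
  have hdvd := Nat.le_of_dvd (Nat.pos_of_ne_zero (mul_ne_zero (Nat.lcmUpto_ne_zero _)
    (mul_ne_zero (mul_ne_zero (Nat.factorial_ne_zero _) (Nat.factorial_ne_zero _))
      (Nat.factorial_ne_zero _)))) (factorial_thirty_mul_dvd k)
  have hf : ∀ n : ℕ, (n.factorial : ℝ) ≠ 0 := fun n => by positivity
  have hl : (Nat.lcmUpto (30 * k) : ℝ) ≠ 0 := by exact_mod_cast Nat.lcmUpto_ne_zero (30 * k)
  have hlog := log_le_log (by positivity) (Nat.cast_le (α := ℝ).2 hdvd)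
  push_cast at hlog
  rw [log_mul (hf _) (hf _), log_mul hl (mul_ne_zero (mul_ne_zero (hf _) (hf _)) (hf _)),
    log_mul (mul_ne_zero (hf _) (hf _)) (hf _), log_mul (hf _) (hf _),
    ← psi_eq_log_lcmUpto] at hlog
  have l30 := Stirling.le_log_factorial_stirling (n := 30 * k) (by omega)
  have l1 := Stirling.le_log_factorial_stirling hk
  have u15 := log_factorial_le (n := 15 * k) (by omega)
  have u10 := log_factorial_le (n := 10 * k) (by omega)
  have u6 := log_factorial_le (n := 6 * k) (by omega)
  have e30 : log 30 = log 2 + log 3 + log 5 := by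
    rw [← log_mul (by norm_num) (by norm_num), ← log_mul (by norm_num) (by norm_num)]; norm_num
  have e15 : log 15 = log 3 + log 5 := by rw [← log_mul (by norm_num) (by norm_num)]; norm_num
  have e10 : log 10 = log 2 + log 5 := by rw [← log_mul (by norm_num) (by norm_num)]; norm_num
  have e6 : log 6 = log 2 + log 3 := by rw [← log_mul (by norm_num) (by norm_num)]; norm_num
  have h32 : log 30 ≤ 5 * log 2 := by
    rw [show 5 * log 2 = log (2 ^ 5) by rw [log_pow]; norm_num]
    exact log_le_log (by norm_num) (by norm_num)
  have hpi : 2 * log 2 ≤ log (2 * π) := by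
    rw [show 2 * log 2 = log (2 ^ 2) by rw [log_pow]; norm_num]
    exact log_le_log (by norm_num) (by linarith [pi_gt_three])
  push_cast at l30 l1 u15 u10 u6 hlog ⊢
  rw [log_mul (by norm_num) hk0.ne'] at l30 u15 u10 u6
  rw [e30] at l30 h32
  rw [e15] at u15
  rw [e10] at u10
  rw [e6] at u6
  have hc := mul_le_mul_of_nonneg_right chebyshev_constant_ge hk0.le
  have := log_two_lt_d9
  have := log_two_gt_d9
  linarith

open Real Chebyshev in
theorem psi_sub_theta_le_sqrt {y : ℝ} (hy : 4096 ≤ y) : ψ y - θ y ≤ 2.64 * √y := by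
  have hy0 : 0 < y := by linarith
  have hlog : 12 * log 2 ≤ log y := by
    rw [show 12 * log 2 = log (2 ^ 12) by rw [log_pow]; norm_num]
    exact log_le_log (by norm_num) (by linarith)
  have hl2 : 0 < log 2 := log_pos (by norm_num)
  have h12 : 12 ≤ ⌊log y / log 2⌋₊ := Nat.le_floor (by
    rw [le_div_iff₀ hl2]; exact_mod_cast hlog)
  set M := ⌊log y / log 2⌋₊ with hM
  have hMle : (M : ℝ) ≤ log y / log 2 := Nat.floor_le (div_nonneg (by linarith) hl2.le)
  rw [psi_eq_theta_add_sum_theta (by linarith), ← hM, add_sub_cancel_left]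
  have hterm : ∀ (n : ℕ) (a : ℝ), 1 / (n : ℝ) ≤ a → θ (y ^ (1 / (n : ℝ))) ≤ log 4 * y ^ a :=
    fun n a h => (theta_le_log4_mul_x (by positivity)).trans (by
      gcongr
      linarith)
  have hsplit : Finset.Icc 2 M = {2, 3, 4, 5} ∪ Finset.Icc 6 M := by
    ext n; simp; omega
  have hdisj : Disjoint ({2, 3, 4, 5} : Finset ℕ) (Finset.Icc 6 M) := by
    rw [Finset.disjoint_left]; intro n hn; simp at hn ⊢; omega
  rw [hsplit, Finset.sum_union hdisj]
  have htail : ∑ n ∈ Finset.Icc 6 M, θ (y ^ (1 / (n : ℝ))) ≤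
      (M - 5) * (log 4 * y ^ (1 / 6 : ℝ)) := by
    refine (Finset.sum_le_card_nsmul _ _ (log 4 * y ^ (1 / 6 : ℝ)) fun n hn => hterm n _ ?_).trans
      (le_of_eq ?_)
    · have : (6 : ℝ) ≤ n := by exact_mod_cast (Finset.mem_Icc.1 hn).1
      gcongr
    · rw [Nat.card_Icc, nsmul_eq_mul, show M + 1 - 6 = M - 5 by omega, Nat.cast_sub (by omega)]
      simp
  have hhead : ∑ n ∈ ({2, 3, 4, 5} : Finset ℕ), θ (y ^ (1 / (n : ℝ))) ≤
      log 4 * (y ^ (1 / 2 : ℝ) + y ^ (1 / 3 : ℝ) + y ^ (1 / 4 : ℝ) + y ^ (5 / 24 : ℝ)) := by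
    have h2 := hterm 2 (1 / 2) (by norm_num)
    have h3 := hterm 3 (1 / 3) (by norm_num)
    have h4 := hterm 4 (1 / 4) (by norm_num)
    have h5 := hterm 5 (5 / 24) (by norm_num)
    rw [Finset.sum_insert (by simp), Finset.sum_insert (by simp), Finset.sum_insert (by simp),
      Finset.sum_singleton]
    linarith
  have hpow : ∀ a b c : ℝ, 0 ≤ a → c = 2 ^ (12 * a) → b + a = 1 / 2 → c * y ^ b ≤ √y := by
    intro a b c ha hc hab
    rw [sqrt_eq_rpow, ← hab, rpow_add hy0, mul_comm, hc, rpow_mul (by norm_num)]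
    gcongr
    norm_num; exact hy
  have p3 := hpow (1 / 6) (1 / 3) 4 (by norm_num) (by norm_num) (by norm_num)
  have p4 := hpow (1 / 4) (1 / 4) 8 (by norm_num) (by norm_num) (by norm_num)
  have p6 := hpow (1 / 3) (1 / 6) 16 (by norm_num) (by norm_num) (by norm_num)
  have p5 := hpow (7 / 24) (5 / 24) (2 ^ (7 / 2 : ℝ)) (by norm_num) (by norm_num) (by norm_num)
  have hc5 : (11 : ℝ) ≤ 2 ^ (7 / 2 : ℝ) := by
    have : ((2 : ℝ) ^ (7 / 2 : ℝ)) ^ 2 = 128 := by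
      rw [← rpow_natCast, ← rpow_mul (by norm_num)]; norm_num
    nlinarith [rpow_pos_of_pos (two_pos : (0 : ℝ) < 2) (7 / 2)]
  have q5 : 11 * y ^ (5 / 24 : ℝ) ≤ √y :=
    le_trans (mul_le_mul_of_nonneg_right hc5 (by positivity)) p5
  -- `t = y ^ (1 / 3)` and `log t ≤ log 16 + (t / 16 - 1)`
  have ht : (16 : ℝ) ≤ y ^ (1 / 3 : ℝ) := by
    have : (16 : ℝ) = (4096 : ℝ) ^ (1 / 3 : ℝ) := by
      rw [show (4096 : ℝ) = 16 ^ (3 : ℝ) by norm_num, ← rpow_mul (by norm_num)]; norm_num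
    rw [this]; gcongr
  have hlogt : log y ≤ 12 * log 2 + 3 * (y ^ (1 / 3 : ℝ) / 16 - 1) := by
    have h := log_le_sub_one_of_pos (show 0 < y ^ (1 / 3 : ℝ) / 16 by positivity)
    rw [log_div (by positivity) (by norm_num), log_rpow hy0,
      show (16 : ℝ) = 2 ^ 4 by norm_num, log_pow] at h
    push_cast at h
    norm_num at h ⊢
    linarith
  have hM' : (M : ℝ) - 5 ≤ 7 / 16 * y ^ (1 / 3 : ℝ) := by
    have : log y / log 2 ≤ 5 + 7 / 16 * y ^ (1 / 3 : ℝ) := by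
      rw [div_le_iff₀ hl2]
      nlinarith [log_two_gt_d9]
    linarith
  have hprod : y ^ (1 / 3 : ℝ) * y ^ (1 / 6 : ℝ) = √y := by
    rw [← rpow_add hy0, sqrt_eq_rpow]; norm_num
  have hl4 : log 4 ≤ 1.3863 := by
    rw [show (4 : ℝ) = 2 ^ 2 by norm_num, log_pow]
    push_cast; linarith [log_two_lt_d9]
  have hl4' : 0 < log 4 := log_pos (by norm_num)
  have htail' : (M - 5) * (log 4 * y ^ (1 / 6 : ℝ)) ≤ log 4 * (7 / 16 * √y) := by
    rw [← hprod]
    calc _ ≤ 7 / 16 * y ^ (1 / 3 : ℝ) * (log 4 * y ^ (1 / 6 : ℝ)) := by gcongr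
      _ = _ := by ring
  have hs := sqrt_nonneg y
  rw [← sqrt_eq_rpow] at hhead
  calc _ ≤ log 4 * (√y + √y / 4 + √y / 8 + √y / 11 + 7 / 16 * √y) := by
        refine (add_le_add hhead (htail.trans htail')).trans ?_
        rw [← mul_add]
        gcongr <;> linarith
    _ ≤ 1.3863 * (√y + √y / 4 + √y / 8 + √y / 11 + 7 / 16 * √y) := by gcongr
    _ ≤ _ := by linarith

open Real Chebyshev in
theorem theta_ge_of_five_thousand_le {n : ℕ} (hn : 5000 ≤ n) :
    0.92 * n - 2.64 * √n - log n / 2 - 31 ≤ θ (n : ℝ) := by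
  have hk : n / 30 ≠ 0 := by omega
  have h1 : 30 * (n / 30) ≤ n := Nat.mul_div_le n 30
  have h1' : ((30 * (n / 30) : ℕ) : ℝ) ≤ n := Nat.cast_le.2 h1
  have h2 : (n : ℝ) ≤ 30 * ((n / 30 : ℕ) : ℝ) + 29 := by
    exact_mod_cast (show n ≤ 30 * (n / 30) + 29 by omega)
  have h3 : (4096 : ℝ) ≤ ((30 * (n / 30) : ℕ) : ℝ) := by
    exact_mod_cast (show 4096 ≤ 30 * (n / 30) by omega)
  have hpsi := psi_thirty_mul_ge hk
  have hdiff := psi_sub_theta_le_sqrt h3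
  have hmono := theta_mono h1'
  have hsqrt := sqrt_le_sqrt h1'
  have hlog : log ((n / 30 : ℕ) : ℝ) ≤ log n := by
    refine log_le_log (by exact_mod_cast Nat.pos_of_ne_zero hk) ?_
    exact_mod_cast Nat.div_le_self n 30
  linarith

/-- Distinct prime classes dividing `b` have norms whose product divides the norm of `b`. -/
theorem prod_natAbs_norm_dvd (T : Finset (Associates GaussianInt)) (hT : ∀ a ∈ T, Prime a)
    (b : GaussianInt) (h : ∀ a ∈ T, a ∣ Associates.mk b) :
    ∏ a ∈ T, (Quotient.out a).norm.natAbs ∣ b.norm.natAbs := by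
  have hdvd := Finset.prod_primes_dvd (Associates.mk b) hT h
  have hprod : ∏ a ∈ T, a = Associates.mk (∏ a ∈ T, Quotient.out a) := by
    rw [← Associates.finsetProd_mk]
    exact Finset.prod_congr rfl fun a _ => (Quotient.out_eq a).symm
  rw [hprod, Associates.mk_dvd_mk] at hdvd
  have := Int.natAbs_dvd_natAbs.2 (map_dvd (Zsqrtd.normMonoidHom (d := -1)) hdvd)
  rw [map_prod, ← Int.natAbsHom_apply, map_prod] at this
  simpa [Zsqrtd.normMonoidHom] using this

/-- A Gaussian prime divides a rational prime dividing its norm. -/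
theorem exists_rational_prime_below {w : GaussianInt} (hw : Prime w) :
    ∃ q : ℕ, q.Prime ∧ q ∣ w.norm.natAbs ∧ w ∣ (q : GaussianInt) := by
  have hne : w.norm.natAbs ≠ 0 := by
    simpa [Int.natAbs_eq_zero, GaussianInt.norm_eq_zero] using hw.ne_zero
  have hdvd : w ∣ ((w.norm.natAbs : ℕ) : GaussianInt) := by
    rw [GaussianInt.natCast_natAbs_norm, Zsqrtd.norm_eq_mul_conj]
    exact dvd_mul_right _ _
  rw [← Nat.prod_primeFactorsList hne, Nat.cast_list_prod, hw.dvd_prod_iff] at hdvd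
  obtain ⟨a, ha, hwa⟩ := hdvd
  obtain ⟨q, hq, rfl⟩ := List.mem_map.1 ha
  exact ⟨q, Nat.prime_of_mem_primeFactorsList hq, Nat.dvd_of_mem_primeFactorsList hq, hwa⟩

/-- At most two prime classes of `ℤ[i]` lie above a rational prime. -/
theorem card_primes_above_le_two {q : ℕ} (hq : q.Prime) (T : Finset (Associates GaussianInt))
    (hT : ∀ a ∈ T, Prime a) (hdvd : ∀ a ∈ T, a ∣ Associates.mk (q : GaussianInt))
    (hnorm : ∀ a ∈ T, q ∣ (Quotient.out a).norm.natAbs) : T.card ≤ 2 := by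
  have h := (Finset.prod_dvd_prod_of_dvd (fun _ => q) _ hnorm).trans
    (prod_natAbs_norm_dvd T hT q hdvd)
  rw [Finset.prod_const, Zsqrtd.norm_natCast, Int.natAbs_mul, Int.natAbs_natCast, ← pow_two] at h
  exact (Nat.pow_dvd_pow_iff_le_right hq.one_lt).1 h

/-- The value at `1 + i` of the polynomial `Φ_g(X ^ (d / g))` with `g = gcd d 30`; it is a multiple
of `Φ_d(1 + i)`. -/
noncomputable def sievedCyclotomicValue (d : ℕ) : GaussianInt :=
  (Polynomial.cyclotomic (d.gcd 30) GaussianInt).eval ((⟨1, 1⟩ : GaussianInt) ^ (d / d.gcd 30))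

theorem norm_toComplex_one_add_I : ‖((⟨1, 1⟩ : GaussianInt) : ℂ)‖ = √2 := by
  rw [GaussianInt.toComplex_def₂, Complex.norm_def, Complex.normSq_mk]
  norm_num

theorem one_add_I_pow_sub_one_ne_zero {k : ℕ} (hk : k ≠ 0) :
    (⟨1, 1⟩ : GaussianInt) ^ k - 1 ≠ 0 := by
  intro h
  have h1 := congrArg (fun w : GaussianInt => ‖(w : ℂ)‖) (sub_eq_zero.1 h)
  simp only [map_pow, norm_pow, norm_toComplex_one_add_I, map_one, norm_one] at h1
  have : 1 < √2 ^ k := one_lt_pow₀ (Real.lt_sqrt_of_sq_lt (by norm_num)) hk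
  linarith

theorem sievedCyclotomicValue_dvd (d : ℕ) :
    sievedCyclotomicValue d ∣ (⟨1, 1⟩ : GaussianInt) ^ d - 1 := by
  have h := Polynomial.eval_dvd (x := (⟨1, 1⟩ : GaussianInt) ^ (d / d.gcd 30))
    (Polynomial.cyclotomic.dvd_X_pow_sub_one (d.gcd 30) GaussianInt)
  simpa [sievedCyclotomicValue, ← pow_mul, Nat.div_mul_cancel (Nat.gcd_dvd_left d 30)] using h

theorem sievedCyclotomicValue_ne_zero {d : ℕ} (hd : d ≠ 0) : sievedCyclotomicValue d ≠ 0 :=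
  ne_zero_of_dvd_ne_zero (one_add_I_pow_sub_one_ne_zero hd) (sievedCyclotomicValue_dvd d)

/-- If `d` is the order of `1 + i` modulo the prime `w`, then `w` divides the value at `d`. -/
theorem exists_dvd_sievedCyclotomicValue {w : GaussianInt} (hw : Prime w) {k : ℕ} (hk : k ≠ 0)
    (hdvd : w ∣ (⟨1, 1⟩ : GaussianInt) ^ k - 1) :
    ∃ d, 1 ≤ d ∧ d ≤ k ∧ w ∣ sievedCyclotomicValue d := by
  classical
  have hex : ∃ d, d ≠ 0 ∧ w ∣ (⟨1, 1⟩ : GaussianInt) ^ d - 1 := ⟨k, hk, hdvd⟩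
  obtain ⟨hd0, hd⟩ := Nat.find_spec hex
  set d := Nat.find hex
  refine ⟨d, Nat.one_le_iff_ne_zero.2 hd0, Nat.find_min' hex ⟨hk, hdvd⟩, ?_⟩
  have hgd := Nat.gcd_dvd_left d 30
  have hg : 0 < d.gcd 30 := Nat.gcd_pos_of_pos_right d (by norm_num)
  have hprod := congrArg (Polynomial.eval ((⟨1, 1⟩ : GaussianInt) ^ (d / d.gcd 30)))
    (Polynomial.prod_cyclotomic_eq_X_pow_sub_one hg GaussianInt)
  rw [Polynomial.eval_prod] at hprod
  simp only [Polynomial.eval_sub, Polynomial.eval_pow, Polynomial.eval_X, Polynomial.eval_one,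
    ← pow_mul, Nat.div_mul_cancel hgd] at hprod
  rw [← hprod, hw.dvd_finsetProd_iff] at hd
  obtain ⟨e, he, hwe⟩ := hd
  have heg := Nat.dvd_of_mem_divisors he
  have he0 : e ≠ 0 := (Nat.pos_of_mem_divisors he).ne'
  rcases eq_or_ne e (d.gcd 30) with rfl | hne
  · exact hwe
  · have h := hwe.trans (Polynomial.eval_dvd (x := (⟨1, 1⟩ : GaussianInt) ^ (d / d.gcd 30))
      (Polynomial.cyclotomic.dvd_X_pow_sub_one e GaussianInt))
    simp only [Polynomial.eval_sub, Polynomial.eval_pow, Polynomial.eval_X, Polynomial.eval_one,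
      ← pow_mul] at h
    have hquot : d / d.gcd 30 ≠ 0 := (Nat.div_pos (Nat.le_of_dvd (by omega) hgd) hg).ne'
    have hlt : d / d.gcd 30 * e < d := by
      conv_rhs => rw [← Nat.div_mul_cancel hgd]
      exact Nat.mul_lt_mul_of_pos_left (lt_of_le_of_ne (Nat.le_of_dvd hg heg) hne)
        (Nat.pos_of_ne_zero hquot)
    exact absurd ⟨mul_ne_zero hquot he0, h⟩ (Nat.find_min hex hlt)

theorem norm_eval_cyclotomic_le (n : ℕ) (w : ℂ) :
    ‖(Polynomial.cyclotomic n ℂ).eval w‖ ≤ (‖w‖ + 1) ^ n.totient := by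
  rcases Nat.eq_zero_or_pos n with rfl | hn
  · simp
  have hprim := Complex.isPrimitiveRoot_exp n hn.ne'
  rw [Polynomial.cyclotomic_eq_prod_X_sub_primitiveRoots hprim, Polynomial.eval_prod,
    norm_prod, ← hprim.card_primitiveRoots]
  rw [← Finset.prod_const]
  refine Finset.prod_le_prod (fun _ _ => norm_nonneg _) fun ζ hζ => ?_
  have hζ1 : ‖ζ‖ = 1 :=
    ((mem_primitiveRoots hn).1 hζ).norm'_eq_one hn.ne'
  simpa [hζ1] using norm_sub_le w ζ

open Real in
theorem log_norm_sievedCyclotomicValue_le {d : ℕ} (hd : d ≠ 0) :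
    log ((sievedCyclotomicValue d).norm.natAbs : ℝ) ≤
      ((d / d.gcd 30 * (d.gcd 30).totient : ℕ) : ℝ) * log 2 +
        2 * ((d.gcd 30).totient * (√2)⁻¹ ^ (d / d.gcd 30)) := by
  set g := d.gcd 30
  set e := d / g
  have hC : ((sievedCyclotomicValue d : GaussianInt) : ℂ) =
      (Polynomial.cyclotomic g ℂ).eval (((⟨1, 1⟩ : GaussianInt) : ℂ) ^ e) := by
    rw [sievedCyclotomicValue, ← map_pow, ← Polynomial.map_cyclotomic g GaussianInt.toComplex,
      Polynomial.eval_map_apply]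
  have hbound : ‖((sievedCyclotomicValue d : GaussianInt) : ℂ)‖ ≤ (√2 ^ e + 1) ^ g.totient := by
    have := norm_eval_cyclotomic_le g (((⟨1, 1⟩ : GaussianInt) : ℂ) ^ e)
    rwa [← hC, norm_pow, norm_toComplex_one_add_I] at this
  have hpos : 0 < ‖((sievedCyclotomicValue d : GaussianInt) : ℂ)‖ :=
    norm_pos_iff.2 (by simpa using sievedCyclotomicValue_ne_zero hd)
  have hcast : ((sievedCyclotomicValue d).norm.natAbs : ℝ) =
      ‖((sievedCyclotomicValue d : GaussianInt) : ℂ)‖ ^ 2 := by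
    rw [GaussianInt.natCast_natAbs_norm, GaussianInt.intCast_real_norm, Complex.normSq_eq_norm_sq]
  have h2 : (0 : ℝ) < √2 := by positivity
  have hlog : log (√2 ^ e + 1) ≤ e * (log 2 / 2) + (√2)⁻¹ ^ e := by
    rw [show √2 ^ e + 1 = √2 ^ e * ((√2)⁻¹ ^ e + 1) by
      rw [inv_pow, mul_add, mul_inv_cancel₀ (by positivity)]; ring,
      log_mul (by positivity) (by positivity), log_pow, log_sqrt (by norm_num)]
    linarith [log_le_sub_one_of_pos (show 0 < (√2)⁻¹ ^ e + 1 by positivity)]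
  have h := log_le_log hpos hbound
  rw [log_pow] at h
  rw [hcast, log_pow]
  have := mul_le_mul_of_nonneg_left hlog (Nat.cast_nonneg (α := ℝ) g.totient)
  push_cast
  linarith

theorem sum_totient_gcd_thirty_le (x : ℕ) :
    100 * ∑ d ∈ Finset.Icc 1 x, d / d.gcd 30 * (d.gcd 30).totient ≤ 32 * x ^ 2 + 55 * x + 100 := by
  set F : ℕ → ℕ := fun d => d / d.gcd 30 * (d.gcd 30).totient with hF
  set a : ℕ → ℕ := fun r => 30 / r.gcd 30 * (r.gcd 30).totient with ha
  have hshift : ∀ q r, F (30 * q + r) = q * a r + F r := by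
    intro q r
    have hg : (30 * q + r).gcd 30 = r.gcd 30 := by simp
    simp only [hF, ha, hg]
    have h1 : (30 * q + r) / r.gcd 30 = q * (30 / r.gcd 30) + r / r.gcd 30 := by
      rw [Nat.add_div_of_dvd_left (Nat.gcd_dvd_left r 30), mul_comm 30 q,
        Nat.mul_div_assoc _ (Nat.gcd_dvd_right r 30)]
    rw [h1]; ring
  have hblock : ∀ q r, ∑ j ∈ Finset.range r, F (30 * q + j) =
      q * ∑ j ∈ Finset.range r, a j + ∑ j ∈ Finset.range r, F j := by
    intro q r
    simp only [hshift, Finset.sum_add_distrib, Finset.mul_sum]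
  have hA : ∑ j ∈ Finset.range 30, a j = 576 := by decide +kernel
  have hB : ∑ j ∈ Finset.range 30, F j = 284 := by decide +kernel
  have hfull : ∀ q, ∑ d ∈ Finset.range (30 * q), F d + 4 * q = 288 * q ^ 2 := by
    intro q
    induction q with
    | zero => simp
    | succ q ih =>
      rw [show 30 * (q + 1) = 30 * q + 30 by ring, Finset.sum_range_add, hblock, hA, hB]
      linarith
  have hcheck : ∀ r < 30, 100 * ∑ j ∈ Finset.range r, a j ≤ 1920 * r + 130 ∧
      100 * ∑ j ∈ Finset.range r, F j + 64 * r + 55 ≤ 32 * r ^ 2 + 32 + 55 * r + 100 := by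
    decide +kernel
  have hrange : ∑ d ∈ Finset.Icc 1 x, F d = ∑ d ∈ Finset.range (x + 1), F d := by
    rw [Finset.sum_range_eq_add_Ico _ (by omega)]
    simp [hF]
    rfl
  rw [hrange]
  obtain ⟨hr1, hr2⟩ := hcheck ((x + 1) % 30) (Nat.mod_lt _ (by norm_num))
  have hx := Nat.div_add_mod (x + 1) 30
  set q := (x + 1) / 30
  set r := (x + 1) % 30
  rw [← hx, Finset.sum_range_add, hblock]
  have hq := hfull q
  have hm := Nat.mul_le_mul_left q hr1
  zify at *
  have hxe : (x : ℤ) = 30 * q + r - 1 := by linarith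
  rw [hxe]
  nlinarith

theorem sum_inv_sqrt_two_pow_le (n : ℕ) : ∑ e ∈ Finset.Icc 1 n, (√2)⁻¹ ^ e ≤ 1 + √2 := by
  have h2 : √2 * √2 = 2 := Real.mul_self_sqrt (by norm_num)
  have hinv : (√2)⁻¹ = √2 / 2 := by
    rw [inv_eq_iff_eq_inv, eq_comm, inv_div, div_eq_iff (by positivity), h2]
  have hsum : ∑ e ∈ Finset.Icc 1 n, (√2)⁻¹ ^ e = (1 + √2) * (1 - (√2)⁻¹ ^ n) := by
    induction n with
    | zero => simp
    | succ n ih =>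
      rw [Finset.sum_Icc_succ_top (by omega), ih, pow_succ, hinv]
      linear_combination ((√2 / 2) ^ n / 2) * h2
  rw [hsum]
  exact mul_le_of_le_one_right (by positivity) (sub_le_self _ (by positivity))

theorem sum_totient_mul_inv_sqrt_two_pow_le (x : ℕ) :
    ∑ d ∈ Finset.Icc 1 x, ((d.gcd 30).totient : ℝ) * (√2)⁻¹ ^ (d / d.gcd 30) ≤
      30 * (1 + √2) := by
  set f : ℕ × ℕ → ℝ := fun t => (t.1.totient : ℝ) * (√2)⁻¹ ^ t.2
  set i : ℕ → ℕ × ℕ := fun d => (d.gcd 30, d / d.gcd 30)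
  have hinj : Set.InjOn i (Finset.Icc 1 x) := by
    intro d _ d' _ h
    simp only [i, Prod.mk.injEq] at h
    rw [← Nat.div_mul_cancel (Nat.gcd_dvd_left d 30), h.2, h.1,
      Nat.div_mul_cancel (Nat.gcd_dvd_left d' 30)]
  have hsub : (Finset.Icc 1 x).image i ⊆ Nat.divisors 30 ×ˢ Finset.Icc 1 x := by
    intro t ht
    obtain ⟨d, hd, rfl⟩ := Finset.mem_image.1 ht
    rw [Finset.mem_Icc] at hd
    have hle := Nat.le_of_dvd (by omega) (Nat.gcd_dvd_left d 30)
    simp only [i, Finset.mem_product, Nat.mem_divisors, Finset.mem_Icc]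
    exact ⟨⟨Nat.gcd_dvd_right d 30, by norm_num⟩,
      Nat.div_pos hle (Nat.gcd_pos_of_pos_right d (by norm_num)),
      (Nat.div_le_self _ _).trans hd.2⟩
  calc _ = ∑ t ∈ (Finset.Icc 1 x).image i, f t := (Finset.sum_image hinj).symm
    _ ≤ ∑ t ∈ Nat.divisors 30 ×ˢ Finset.Icc 1 x, f t :=
        Finset.sum_le_sum_of_subset_of_nonneg hsub fun _ _ _ => by positivity
    _ = (∑ g ∈ Nat.divisors 30, (g.totient : ℝ)) * ∑ e ∈ Finset.Icc 1 x, (√2)⁻¹ ^ e := by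
        rw [Finset.sum_mul_sum, Finset.sum_product]
    _ = 30 * ∑ e ∈ Finset.Icc 1 x, (√2)⁻¹ ^ e := by
        rw [← Nat.cast_sum, Nat.sum_totient]; norm_num
    _ ≤ _ := by gcongr; exact sum_inv_sqrt_two_pow_le x

open Real in
theorem log_norm_prod_sievedCyclotomicValue_le (x : ℕ) :
    log ((∏ d ∈ Finset.Icc 1 x, sievedCyclotomicValue d).norm.natAbs : ℝ) ≤
      (0.32 * x ^ 2 + 0.55 * x + 1) * log 2 + 145 := by
  have hne : ∀ d ∈ Finset.Icc 1 x, d ≠ 0 := fun d hd => by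
    rw [Finset.mem_Icc] at hd; omega
  have hprod : (∏ d ∈ Finset.Icc 1 x, sievedCyclotomicValue d).norm.natAbs =
      ∏ d ∈ Finset.Icc 1 x, (sievedCyclotomicValue d).norm.natAbs := by
    exact map_prod (Int.natAbsHom.toMonoidHom.comp (Zsqrtd.normMonoidHom (d := -1)))
      sievedCyclotomicValue (Finset.Icc 1 x)
  have hnorm : ∀ d ∈ Finset.Icc 1 x, ((sievedCyclotomicValue d).norm.natAbs : ℝ) ≠ 0 :=
    fun d hd => by
      simpa [GaussianInt.norm_eq_zero] using sievedCyclotomicValue_ne_zero (hne d hd)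
  rw [hprod, Nat.cast_prod, log_prod hnorm]
  refine (Finset.sum_le_sum fun d hd => log_norm_sievedCyclotomicValue_le (hne d hd)).trans ?_
  rw [Finset.sum_add_distrib, ← Finset.sum_mul, ← Finset.mul_sum, ← Nat.cast_sum]
  have h1 : (100 : ℝ) * ((∑ d ∈ Finset.Icc 1 x, d / d.gcd 30 * (d.gcd 30).totient : ℕ) : ℝ) ≤
      32 * x ^ 2 + 55 * x + 100 := by exact_mod_cast sum_totient_gcd_thirty_le x
  have h2 := sum_totient_mul_inv_sqrt_two_pow_le x
  have h3 : √2 ≤ 1.4143 := sqrt_le_iff.2 (by norm_num)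
  have h4 : ((∑ d ∈ Finset.Icc 1 x, d / d.gcd 30 * (d.gcd 30).totient : ℕ) : ℝ) * log 2 ≤
      (0.32 * x ^ 2 + 0.55 * x + 1) * log 2 := by
    gcongr
    linarith
  linarith

open Real Chebyshev in
/-- If the values of `f` on `S` are odd primes, each taken at most twice, and `y` is the `h`-th odd
prime with `2 * h ≤ #S`, then the product of the values is at least the square of the product of the
odd primes up to `y`. -/
theorem two_mul_theta_sub_log_two_le {α : Type*} (S : Finset α) (f : α → ℕ)
    (hf : ∀ a ∈ S, (f a).Prime ∧ f a ≠ 2) (hfib : ∀ q, {a ∈ S | f a = q}.card ≤ 2)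
    {h y : ℕ} (hy : 2 ≤ y) (hh : {q ∈ Finset.range (y + 1) | q.Prime ∧ q ≠ 2}.card = h)
    (hS : 2 * h ≤ S.card) :
    2 * (θ (y : ℝ) - log 2) ≤ ∑ a ∈ S, log (f a) := by
  set Q := {q ∈ Finset.range (y + 1) | q.Prime ∧ q ≠ 2} with hQ
  have hy0 : (0 : ℝ) < y := by positivity
  have hlogy : 0 ≤ log (y : ℝ) := log_natCast_nonneg y
  have htheta : θ (y : ℝ) = ∑ q ∈ Q, log (q : ℝ) + log 2 := by
    have hle : Nat.primesLE y = insert 2 Q := by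
      ext q
      simp only [Nat.mem_primesLE, hQ, Finset.mem_insert, Finset.mem_filter, Finset.mem_range]
      constructor
      · rintro ⟨h1, h2⟩
        by_cases hq : q = 2
        · exact Or.inl hq
        · exact Or.inr ⟨by omega, h2, hq⟩
      · rintro (rfl | ⟨h1, h2, -⟩)
        · exact ⟨hy, Nat.prime_two⟩
        · exact ⟨by omega, h2⟩
    rw [theta_eq_sum_primesLE_log, hle, Finset.sum_insert (by simp [hQ])]
    push_cast; ring
  have hneg : ∀ q ∈ Q, log (q : ℝ) - log y ≤ 0 := by
    intro q hq
    simp only [hQ, Finset.mem_filter, Finset.mem_range] at hq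
    exact sub_nonpos.2 (log_le_log (by exact_mod_cast hq.2.1.pos)
      (by exact_mod_cast Nat.lt_succ_iff.1 hq.1))
  have hbig : ∀ a ∈ S, f a ∉ Q → 0 ≤ log (f a : ℝ) - log y := by
    intro a ha hq
    have hlt : y < f a := by
      by_contra hle
      exact hq (Finset.mem_filter.2 ⟨Finset.mem_range.2 (by omega), hf a ha⟩)
    exact sub_nonneg.2 (log_le_log hy0 (by exact_mod_cast hlt.le))
  have hsmall : ∑ q ∈ Q, 2 * (log (q : ℝ) - log y) ≤
      ∑ a ∈ S with f a ∈ Q, (log (f a : ℝ) - log y) := by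
    rw [← Finset.sum_fiberwise_of_maps_to (t := Q) (g := f)
      (fun a ha => (Finset.mem_filter.1 ha).2)]
    refine Finset.sum_le_sum fun q hq => ?_
    rw [Finset.sum_congr rfl (g := fun _ => log (q : ℝ) - log y)
      (fun a ha => by rw [(Finset.mem_filter.1 ha).2]), Finset.sum_const, nsmul_eq_mul]
    refine mul_le_mul_of_nonpos_right ?_ (hneg q hq)
    have : (({a ∈ S | f a ∈ Q} : Finset α).filter (fun a => f a = q)).card ≤ 2 :=
      (Finset.card_le_card (Finset.filter_subset_filter _ (Finset.filter_subset _ _))).trans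
        (hfib q)
    exact_mod_cast this
  have hsum : ∑ q ∈ Q, 2 * (log (q : ℝ) - log y) ≤ ∑ a ∈ S, (log (f a : ℝ) - log y) := by
    rw [← Finset.sum_filter_add_sum_filter_not S (fun a => f a ∈ Q)]
    have : 0 ≤ ∑ a ∈ S with f a ∉ Q, (log (f a : ℝ) - log y) :=
      Finset.sum_nonneg fun a ha =>
        hbig a (Finset.mem_filter.1 ha).1 (Finset.mem_filter.1 ha).2
    linarith
  rw [← Finset.mul_sum, Finset.sum_sub_distrib, Finset.sum_sub_distrib, Finset.sum_const,
    Finset.sum_const, nsmul_eq_mul, nsmul_eq_mul, hh] at hsum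
  have hS' : (2 : ℝ) * h ≤ S.card := by exact_mod_cast hS
  have := mul_le_mul_of_nonneg_right hS' hlogy
  rw [htheta]
  linarith

theorem infinite_odd_primes : {q : ℕ | q.Prime ∧ q ≠ 2}.Infinite :=
  Nat.infinite_setOfPred_prime.sdiff (Set.finite_singleton 2)

theorem card_odd_primes_le_oddPrime {h : ℕ} (hh : h ≠ 0) :
    {q ∈ Finset.range (oddPrime h + 1) | q.Prime ∧ q ≠ 2}.card = h := by
  rw [← Nat.count_eq_card_filter_range, oddPrime, Nat.count_succ,
    Nat.count_nth_of_infinite infinite_odd_primes, if_pos (Nat.nth_mem_of_infinite infinite_odd_primes (h - 1))]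
  omega

open Real in
theorem lt_of_sieve_bound {x : ℕ} (hx : 200 ≤ x) {y : ℕ}
    (h : 2 * (Chebyshev.theta y - log 2) ≤ (0.32 * x ^ 2 + 0.55 * x + 1) * log 2 + 145) :
    (y : ℝ) < 0.130448 * (x : ℝ) ^ 2 := by
  by_contra! hy
  have hxr : (200 : ℝ) ≤ x := by exact_mod_cast hx
  have hy5 : 5000 ≤ y := by
    have : (5000 : ℝ) ≤ y := by nlinarith
    exact_mod_cast this
  have htheta := theta_ge_of_five_thousand_le hy5
  set s := √(y : ℝ) with hs
  have hsq : (y : ℝ) = s ^ 2 := (sq_sqrt (Nat.cast_nonneg y)).symm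
  have hsx : 0.36117 * x ≤ s := le_sqrt_of_sq_le (by nlinarith)
  have hs0 : 0 < s := by linarith
  have hlog : log (y : ℝ) ≤ 2 * (s / 64 + 6 * log 2 - 1) := by
    have h64 := log_le_sub_one_of_pos (show 0 < s / 64 by positivity)
    rw [log_div hs0.ne' (by norm_num), show (64 : ℝ) = 2 ^ 6 by norm_num, log_pow] at h64
    rw [hsq, log_pow]
    push_cast at h64 ⊢
    norm_num at h64 ⊢
    linarith
  have hl2 := log_two_lt_d9
  have hrhs : (0.32 * (x : ℝ) ^ 2 + 0.55 * x + 1) * log 2 ≤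
      (0.32 * (x : ℝ) ^ 2 + 0.55 * x + 1) * 0.6931471808 := by gcongr
  have hmono : 0.92 * (0.36117 * x) ^ 2 - 2.66 * (0.36117 * x) ≤ 0.92 * s ^ 2 - 2.66 * s := by
    nlinarith
  have hquad : 0 < 0.0091 * (x : ℝ) ^ 2 - 1.152 * x - 108 := by nlinarith
  linarith

/-- **Bound on the largest needed odd prime.** For an integer `x ≥ 200`, if
`D = ∏_{k=⌈x/2⌉}^{x} ((1+i)^k - 1)` has exactly `m` pairwise non-associate prime factors
in `ℤ[i]`, then the `⌊m/2⌋`-th smallest odd rational prime is less than `0.130448 x²`. -/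
theorem odd_prime_bound_for_gaussian_product (x : ℕ) (hx : 200 ≤ x) (m : ℕ)
    (hm : m = Nat.card {p : Associates GaussianInt // Irreducible p ∧
      p ∣ Associates.mk (∏ k ∈ Finset.Icc ((x + 1) / 2) x,
        ((⟨1, 1⟩ : GaussianInt) ^ k - 1))}) :
    (oddPrime (m / 2) : ℝ) < 0.130448 * (x : ℝ) ^ 2 := by
  rcases Nat.eq_zero_or_pos (m / 2) with hzero | hpos
  · have h3 : oddPrime 0 ≤ 3 := by
      have := Nat.nth_count (p := fun p : ℕ => p.Prime ∧ p ≠ 2) (n := 3) (by norm_num)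
      rw [← this]
      exact Nat.nth_monotone infinite_odd_primes (Nat.zero_le _)
    have h3' : (oddPrime 0 : ℝ) ≤ 3 := by exact_mod_cast h3
    have hxr : (200 : ℝ) ≤ x := by exact_mod_cast hx
    rw [hzero]
    nlinarith
  refine lt_of_sieve_bound hx (le_trans ?_ (log_norm_prod_sievedCyclotomicValue_le x))
  set D := ∏ k ∈ Finset.Icc ((x + 1) / 2) x, ((⟨1, 1⟩ : GaussianInt) ^ k - 1) with hD
  have hfin : Finite {p : Associates GaussianInt // Irreducible p ∧ p ∣ Associates.mk D} :=
    Nat.finite_of_card_ne_zero (by omega)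
  have hfinset : {p : Associates GaussianInt | Irreducible p ∧ p ∣ Associates.mk D}.Finite := hfin
  set S := hfinset.toFinset
  have hS : S.card = m := by
    rw [hm]; exact (Nat.card_eq_card_finite_toFinset hfinset).symm
  have hprime : ∀ a ∈ S, Prime a := fun a ha =>
    UniqueFactorizationMonoid.irreducible_iff_prime.1 (hfinset.mem_toFinset.1 ha).1
  have hout : ∀ a : Associates GaussianInt, Associates.mk (Quotient.out a) = a := Quotient.out_eq
  have hprime' : ∀ a ∈ S, Prime (Quotient.out a) := fun a ha =>
    Associates.prime_mk.1 (by rw [hout]; exact hprime a ha)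
  have hfactor : ∀ a ∈ S, ∃ k ∈ Finset.Icc ((x + 1) / 2) x,
      Quotient.out a ∣ (⟨1, 1⟩ : GaussianInt) ^ k - 1 := fun a ha => by
    have hdvd := (hfinset.mem_toFinset.1 ha).2
    rw [← hout a, Associates.mk_dvd_mk, hD, (hprime' a ha).dvd_finsetProd_iff] at hdvd
    exact hdvd
  have hsieve : ∀ a ∈ S, a ∣ Associates.mk (∏ d ∈ Finset.Icc 1 x, sievedCyclotomicValue d) := by
    intro a ha
    obtain ⟨k, hk, hdvd⟩ := hfactor a ha
    rw [Finset.mem_Icc] at hk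
    obtain ⟨d, hd1, hdk, hdvd'⟩ :=
      exists_dvd_sievedCyclotomicValue (hprime' a ha) (by omega) hdvd
    rw [← hout a, Associates.mk_dvd_mk]
    exact hdvd'.trans (Finset.dvd_prod_of_mem _ (Finset.mem_Icc.2 ⟨hd1, hdk.trans hk.2⟩))
  have hbelow : ∀ a : Associates GaussianInt, ∃ q : ℕ, a ∈ S → q.Prime ∧
      q ∣ (Quotient.out a).norm.natAbs ∧ Quotient.out a ∣ (q : GaussianInt) := fun a => by
    by_cases ha : a ∈ S
    · obtain ⟨q, hq⟩ := exists_rational_prime_below (hprime' a ha)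
      exact ⟨q, fun _ => hq⟩
    · exact ⟨0, fun h => absurd h ha⟩
  choose f hf using hbelow
  have hodd : ∀ a ∈ S, f a ≠ 2 := by
    intro a ha h2
    obtain ⟨k, hk, hdvd⟩ := hfactor a ha
    rw [Finset.mem_Icc] at hk
    have htwo : Quotient.out a ∣ (⟨1, 1⟩ : GaussianInt) ^ 2 := by
      refine (hf a ha).2.2.trans ?_
      rw [h2]
      exact ⟨⟨0, 1⟩, by decide⟩
    have hone : Quotient.out a ∣ (⟨1, 1⟩ : GaussianInt) ^ k :=
      htwo.trans (pow_dvd_pow _ (by omega))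
    exact (hprime' a ha).not_isUnit (isUnit_of_dvd_one (by simpa using dvd_sub hone hdvd))
  have hfib : ∀ q, {a ∈ S | f a = q}.card ≤ 2 := by
    intro q
    rcases Finset.eq_empty_or_nonempty {a ∈ S | f a = q} with hempty | ⟨b, hb⟩
    · simp [hempty]
    obtain ⟨hbS, hbq⟩ := Finset.mem_filter.1 hb
    refine card_primes_above_le_two (hbq ▸ (hf b hbS).1) _
      (fun a ha => hprime a (Finset.mem_filter.1 ha).1) (fun a ha => ?_) (fun a ha => ?_)
    · obtain ⟨haS, rfl⟩ := Finset.mem_filter.1 ha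
      conv_lhs => rw [← hout a]
      exact Associates.mk_dvd_mk.2 (hf a haS).2.2
    · obtain ⟨haS, rfl⟩ := Finset.mem_filter.1 ha
      exact (hf a haS).2.1
  have hmem : (oddPrime (m / 2)).Prime := (Nat.nth_mem_of_infinite infinite_odd_primes (m / 2 - 1)).1
  refine (two_mul_theta_sub_log_two_le S f (fun a ha => ⟨(hf a ha).1, hodd a ha⟩) hfib
    hmem.two_le (card_odd_primes_le_oddPrime hpos.ne') (by omega)).trans ?_
  have hnormpos : ∀ a ∈ S, 0 < (Quotient.out a).norm.natAbs := fun a ha => by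
    simpa [Int.natAbs_pos, GaussianInt.norm_eq_zero] using (hprime' a ha).ne_zero
  have hprodne : (∏ d ∈ Finset.Icc 1 x, sievedCyclotomicValue d) ≠ 0 :=
    Finset.prod_ne_zero_iff.2 fun d hd =>
      sievedCyclotomicValue_ne_zero (by rw [Finset.mem_Icc] at hd; omega)
  have hle : ∏ a ∈ S, f a ≤ (∏ d ∈ Finset.Icc 1 x, sievedCyclotomicValue d).norm.natAbs :=
    (Finset.prod_le_prod' fun a ha => Nat.le_of_dvd (hnormpos a ha) (hf a ha).2.1).trans
      (Nat.le_of_dvd (by simpa [Int.natAbs_pos, GaussianInt.norm_eq_zero] using hprodne)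
        (prod_natAbs_norm_dvd S hprime _ hsieve))
  have hfpos : ∀ a ∈ S, (f a : ℝ) ≠ 0 := fun a ha => by exact_mod_cast (hf a ha).1.ne_zero
  rw [← Real.log_prod hfpos, ← Nat.cast_prod]
  refine Real.log_le_log ?_ (by exact_mod_cast hle)
  exact_mod_cast Finset.prod_pos fun a ha => (hf a ha).1.pos
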